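/- For every nondeterministic Büchi word automaton N with n ≥ 1 states there exists a deterministic parity word automaton D with at most 2·n^n·n! states and parity index 2n such that L(D) = L(N). -/

import Mathlib

/-- The set of states occurring infinitely often in an infinite sequence. -/
def InfOcc {S : Type} (r : ℕ → S) : Set S :=
  {s | ∀ N : ℕ, ∃ n, N ≤ n ∧ r n = s}

/-- `r` is a run of the nondeterministic automaton with transition function `δ`
and initial state `s0` on the infinite word `w`. -/
def IsRun {A S : Type} (δ : S → A → Set S) (s0 : S) (w : ℕ → A) (r : ℕ → S) : Prop :=
  r 0 = s0 ∧ ∀ j, r (j + 1) ∈ δ (r j) (w j)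

/-- The language of a nondeterministic Büchi word automaton:
some run visits the acceptance set `acc` infinitely often. -/
def BuchiLang {A S : Type} (δ : S → A → Set S) (s0 : S) (acc : Set S) : Set (ℕ → A) :=
  {w | ∃ r, IsRun δ s0 w r ∧ (InfOcc r ∩ acc).Nonempty}

/-- The language of a nondeterministic Streett word automaton with pairs
`⟨R i, G i⟩`: some run `r` satisfies, for every `i`,
`inf(r) ∩ G i = ∅` or `inf(r) ∩ R i ≠ ∅`. -/
def StreettLang {A S : Type} {k : ℕ} (δ : S → A → Set S) (s0 : S)
    (R G : Fin k → Set S) : Set (ℕ → A) :=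
  {w | ∃ r, IsRun δ s0 w r ∧ ∀ i, InfOcc r ∩ G i = ∅ ∨ (InfOcc r ∩ R i).Nonempty}

/-- The unique run of a deterministic automaton with transition function `δ`
and initial state `s0` on the infinite word `w`. -/
def DetRun {A S : Type} (δ : S → A → S) (s0 : S) (w : ℕ → A) : ℕ → S
  | 0 => s0
  | j + 1 => δ (DetRun δ s0 w j) (w j)

/-- `F` is a partition of the state space into `k` (possibly empty) classes. -/
def IsPartition {S : Type} {k : ℕ} (F : Fin k → Set S) : Prop :=
  (∀ i j : Fin k, i ≠ j → F i ∩ F j = ∅) ∧ (⋃ i, F i) = Set.univ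

/-- A run is accepted by the parity condition `F 0, …, F (k-1)` iff the least
`i` such that `inf(r) ∩ F i ≠ ∅` is even. -/
def ParityAccept {S : Type} {k : ℕ} (F : Fin k → Set S) (r : ℕ → S) : Prop :=
  ∃ i : Fin k, Even (i : ℕ) ∧ (InfOcc r ∩ F i).Nonempty ∧
    ∀ j : Fin k, j < i → InfOcc r ∩ F j = ∅

/-- A run is accepted by the Rabin condition with pairs `⟨E i, F i⟩` iff for
some `i`, `inf(r) ∩ E i = ∅` and `inf(r) ∩ F i ≠ ∅`. -/
def RabinAccept {S : Type} {k : ℕ} (E F : Fin k → Set S) (r : ℕ → S) : Prop :=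
  ∃ i : Fin k, InfOcc r ∩ E i = ∅ ∧ (InfOcc r ∩ F i).Nonempty

/-- Membership bits of `X`, ordered lexicographically with small indices most significant. -/
def bitKey (X : Finset ℕ) : Lex (ℕ → Bool) := toLex fun i => decide (i ∈ X)

theorem bitKey_le {X Y : Finset ℕ} (h : bitKey X ≤ bitKey Y) :
    X = Y ∨ ∃ d ∈ Y, d ∉ X ∧ ∀ j < d, (j ∈ X ↔ j ∈ Y) := by
  rcases h.eq_or_lt with h | ⟨d, h1, h2⟩
  · left
    ext i
    have := congrFun (congrArg ofLex h) i
    simpa [bitKey] using this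
  · right
    have hd : d ∈ Y ∧ d ∉ X := by
      simp only [bitKey, Bool.lt_iff] at h2
      simpa [and_comm] using h2
    exact ⟨d, hd.1, hd.2, fun j hj => by simpa [bitKey] using h1 j hj⟩

/-- A column `i` of the labelling `g` is inhabited. -/
def Occ {S : Type} (g : S → Finset ℕ) (i : ℕ) : Prop := ∃ q, i ∈ g q

/-- The column `i` is inhabited and covered by later columns. -/
def Green {S : Type} (g : S → Finset ℕ) (i : ℕ) : Prop :=
  Occ g i ∧ ∀ q, i ∈ g q → ∃ j ∈ g q, i < j

open Classical in
/-- Remove everything strictly below a green column. -/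
noncomputable def collapse {S : Type} (g : S → Finset ℕ) (q : S) : Finset ℕ :=
  {i ∈ g q | ∀ j ∈ g q, j < i → ¬ Green g j}

open Classical in
/-- The number of inhabited columns before `i`. -/
noncomputable def colRank {S : Type} (g : S → Finset ℕ) (i : ℕ) : ℕ := Nat.count (Occ g) i

/-- Rename the inhabited columns so that they form an initial segment. -/
noncomputable def compress {S : Type} (g : S → Finset ℕ) (q : S) : Finset ℕ :=
  (g q).image (colRank g)

/-- The first uninhabited column. -/
noncomputable def gap {S : Type} (g : S → Finset ℕ) : ℕ := sInf {i | ¬ Occ g i}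

open Classical in
/-- The priority emitted when the labelling `g` is collapsed. -/
noncomputable def prio {S : Type} (g : S → Finset ℕ) : ℕ :=
  if ∃ f < gap (collapse g), Green g f then 2 * sInf {f | f < gap (collapse g) ∧ Green g f}
  else 2 * (gap (collapse g) - 1) + 1

open Classical in
/-- The successor labelling: every state inherits the best label among its predecessors, and
accepting states are additionally put into a fresh column. -/
noncomputable def spawn {A S : Type} [Fintype S] (δ : S → A → Set S) (acc : Set S)
    (h : S → Finset ℕ) (a : A) (q' : S) : Finset ℕ :=
  if H : ∃ b, q' ∈ δ b a ∧ (h b).Nonempty ∧ ∀ p, q' ∈ δ p a → bitKey (h p) ≤ bitKey (h b) then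
    h H.choose ∪ if q' ∈ acc then {Fintype.card S + (h H.choose).sup id} else ∅
  else ∅

section Labelling

variable {S : Type} {g : S → Finset ℕ}

theorem mem_collapse {q : S} {i : ℕ} :
    i ∈ collapse g q ↔ i ∈ g q ∧ ∀ j ∈ g q, j < i → ¬ Green g j := by
  simp [collapse]

theorem exists_not_occ [Finite S] (g : S → Finset ℕ) : ∃ K, ∀ i, Occ g i → i < K := by
  have := Fintype.ofFinite S
  refine ⟨Finset.univ.sup (fun q => (g q).sup Nat.succ), fun i ⟨q, hq⟩ => ?_⟩
  refine lt_of_lt_of_le (Nat.lt_succ_self i) ?_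
  exact le_trans (Finset.le_sup (f := Nat.succ) hq)
    (Finset.le_sup (f := fun q => (g q).sup Nat.succ) (Finset.mem_univ q))

theorem occ_of_lt_gap {i : ℕ} (hi : i < gap g) : Occ g i := by
  by_contra h
  exact absurd (Nat.sInf_le (show i ∈ {i | ¬ Occ g i} from h)) (by unfold gap at hi; omega)

theorem not_occ_gap [Finite S] (g : S → Finset ℕ) : ¬ Occ g (gap g) := by
  obtain ⟨K, hK⟩ := exists_not_occ g
  exact Nat.sInf_mem (s := {i | ¬ Occ g i}) ⟨K, fun h => lt_irrefl _ (hK K h)⟩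

theorem lt_gap_of_forall [Finite S] {i : ℕ} (h : ∀ j ≤ i, Occ g j) : i < gap g := by
  by_contra hi
  exact not_occ_gap g (h _ (by omega))

theorem colRank_le (i : ℕ) : colRank g i ≤ i := by
  classical
  exact Nat.count_le _

theorem colRank_eq_of_le_gap {i : ℕ} (hi : i ≤ gap g) : colRank g i = i := by
  classical
  exact Nat.count_iff_forall.2 fun j hj => occ_of_lt_gap (by omega)

theorem occ_of_colRank_eq {i j : ℕ} (hi : colRank g i = i) (hj : j < i) : Occ g j := by
  classical
  exact Nat.count_iff_forall.1 hi j hj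

theorem colRank_lt {i j : ℕ} (hi : Occ g i) (hij : i < j) : colRank g i < colRank g j := by
  classical
  exact Nat.count_strict_mono hi hij

theorem le_of_colRank_le {i j : ℕ} (hj : Occ g j) (h : colRank g i ≤ colRank g j) : i ≤ j := by
  by_contra hlt
  exact absurd (colRank_lt hj (not_le.1 hlt)) (by omega)

theorem colRank_injective {i j : ℕ} (hi : Occ g i) (hj : Occ g j)
    (h : colRank g i = colRank g j) : i = j :=
  le_antisymm (le_of_colRank_le hj h.le) (le_of_colRank_le hi h.ge)

theorem exists_colRank_eq {K i : ℕ} (h : i < colRank g K) :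
    ∃ j < K, Occ g j ∧ colRank g j = i := by
  classical
  induction K with
  | zero => simp [colRank] at h
  | succ K ih =>
    by_cases hi : i < colRank g K
    · obtain ⟨j, hj, h'⟩ := ih hi
      exact ⟨j, by omega, h'⟩
    · by_cases hK : Occ g K
      · refine ⟨K, by omega, hK, ?_⟩
        simp only [colRank, Nat.count_succ, hK, if_true] at h hi ⊢
        omega
      · simp only [colRank, Nat.count_succ, hK, if_false] at h hi
        omega

theorem mem_compress {q : S} {x : ℕ} : x ∈ compress g q ↔ ∃ i ∈ g q, colRank g i = x := by
  simp [compress]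

/-- Columns before the gap keep their names. -/
theorem mem_compress_of_lt_gap {q : S} {i : ℕ} (hi : i < gap g) :
    i ∈ compress g q ↔ i ∈ g q := by
  rw [mem_compress]
  constructor
  · rintro ⟨j, hj, h⟩
    have := colRank_injective ⟨q, hj⟩ (occ_of_lt_gap hi)
      (h.trans (colRank_eq_of_le_gap hi.le).symm)
    exact this ▸ hj
  · exact fun h => ⟨i, h, colRank_eq_of_le_gap hi.le⟩

/-- A column together with the path leading to it is the same for all states it contains. -/
def TreeLike (g : S → Finset ℕ) : Prop :=
  ∀ q q' i, i ∈ g q → i ∈ g q' → ∀ j ≤ i, j ∈ g q → j ∈ g q'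

/-- All inhabited labels contain the root column. -/
def Rooted (g : S → Finset ℕ) : Prop := ∀ q i, i ∈ g q → 0 ∈ g q

theorem TreeLike.collapse (hg : TreeLike g) : TreeLike (collapse g) := by
  intro q q' i hi hi' j hj hjq
  rw [mem_collapse] at hi hi' hjq ⊢
  refine ⟨hg q q' i hi.1 hi'.1 j hj hjq.1, fun k hk hkj => ?_⟩
  exact hjq.2 k (hg q' q i hi'.1 hi.1 k (by omega) hk) hkj

theorem Rooted.collapse (hg : Rooted g) : Rooted (collapse g) := by
  intro q i hi
  rw [mem_collapse] at hi ⊢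
  exact ⟨hg q i hi.1, by simp⟩

theorem TreeLike.compress (hg : TreeLike g) : TreeLike (compress g) := by
  intro q q' x hx hx' y hy hyq
  rw [mem_compress] at hx hx' hyq ⊢
  obtain ⟨i, hi, rfl⟩ := hx
  obtain ⟨i', hi', he⟩ := hx'
  obtain ⟨j, hj, rfl⟩ := hyq
  obtain rfl := colRank_injective ⟨q', hi'⟩ ⟨q, hi⟩ he
  exact ⟨j, hg q q' i' hi hi' j (le_of_colRank_le ⟨q, hi⟩ hy) hj, rfl⟩

theorem Rooted.compress (hg : Rooted g) : Rooted (compress g) := by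
  intro q x hx
  rw [mem_compress] at hx ⊢
  obtain ⟨i, hi, rfl⟩ := hx
  exact ⟨0, hg q i hi, by simpa using colRank_le (g := g) 0⟩

/-- After collapsing, every inhabited column is the last column of some state. -/
theorem exists_last_collapse (hg : TreeLike g) {i : ℕ} (hi : Occ (collapse g) i) :
    ∃ q, i ∈ collapse g q ∧ ∀ j ∈ collapse g q, j ≤ i := by
  obtain ⟨q, hq⟩ := hi
  by_cases hG : Green g i
  · refine ⟨q, hq, fun j hj => ?_⟩
    by_contra hlt
    exact (mem_collapse.1 hj).2 i (mem_collapse.1 hq).1 (by omega) hG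
  · have hq' := mem_collapse.1 hq
    have : ∃ p, i ∈ g p ∧ ∀ j ∈ g p, j ≤ i := by
      by_contra hcon
      push Not at hcon
      exact hG ⟨⟨q, hq'.1⟩, hcon⟩
    obtain ⟨p, hp, hmax⟩ := this
    refine ⟨p, mem_collapse.2 ⟨hp, fun k hk hki => ?_⟩,
      fun j hj => hmax j (mem_collapse.1 hj).1⟩
    exact hq'.2 k (hg p q i hp hq'.1 k hki.le hk) hki

theorem card_le_of_forall_last [Fintype S] {m : ℕ}
    (h : ∀ i < m, ∃ q, i ∈ g q ∧ ∀ j ∈ g q, j ≤ i) : m ≤ Fintype.card S := by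
  choose f hf1 hf2 using fun i : Fin m => h i i.2
  have : Function.Injective f := by
    intro i j hij
    apply Fin.ext
    exact le_antisymm (hf2 j i (hij ▸ hf1 i)) (hf2 i j (hij ▸ hf1 j))
  simpa using Fintype.card_le_of_injective f this

end Labelling

/-- The macrostates of the parity automaton: a tree-shaped labelling whose inhabited columns
form an initial segment, together with a priority. -/
def ValidState {S : Type} [Fintype S] (x : (S → Finset ℕ) × ℕ) : Prop :=
  TreeLike x.1 ∧ Rooted x.1 ∧ ∃ m, (∀ i, Occ x.1 i ↔ i < m) ∧
    (∀ i < m, ∃ q, i ∈ x.1 q ∧ ∀ j ∈ x.1 q, j ≤ i) ∧ x.2 < 2 * max m 1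

theorem prio_eq_or {S : Type} (g : S → Finset ℕ) :
    (∃ f < gap (collapse g), Green g f ∧ prio g = 2 * f) ∨
      prio g = 2 * (gap (collapse g) - 1) + 1 := by
  classical
  by_cases h : ∃ f < gap (collapse g), Green g f
  · left
    have := Nat.sInf_mem (s := {f | f < gap (collapse g) ∧ Green g f}) h
    exact ⟨_, this.1, this.2, by rw [prio, if_pos h]⟩
  · right
    rw [prio, if_neg h]

theorem prio_of_green {S : Type} {g : S → Finset ℕ} {i : ℕ} (hi : i < gap (collapse g))
    (hG : Green g i) : ∃ f ≤ i, prio g = 2 * f := by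
  classical
  refine ⟨_, Nat.sInf_le (s := {f | f < gap (collapse g) ∧ Green g f}) ⟨hi, hG⟩, ?_⟩
  rw [prio, if_pos ⟨i, hi, hG⟩]

section Step

variable {A S : Type} [Fintype S] {δ : S → A → Set S} {acc : Set S} {h : S → Finset ℕ} {a : A}

theorem spawn_spec {q' : S} (hne : (spawn δ acc h a q').Nonempty) :
    ∃ b, q' ∈ δ b a ∧ (h b).Nonempty ∧ (∀ p, q' ∈ δ p a → bitKey (h p) ≤ bitKey (h b)) ∧
      ∀ i, i ∈ spawn δ acc h a q' ↔
        i ∈ h b ∨ q' ∈ acc ∧ i = Fintype.card S + (h b).sup id := by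
  classical
  by_cases H : ∃ b, q' ∈ δ b a ∧ (h b).Nonempty ∧ ∀ p, q' ∈ δ p a → bitKey (h p) ≤ bitKey (h b)
  · refine ⟨H.choose, H.choose_spec.1, H.choose_spec.2.1, H.choose_spec.2.2, fun i => ?_⟩
    rw [spawn, dif_pos H]
    split_ifs with hacc <;> simp [hacc, or_comm]
  · rw [spawn, dif_neg H] at hne
    simp at hne

theorem spawn_nonempty {p q' : S} (hp : (h p).Nonempty) (hq : q' ∈ δ p a) :
    (spawn δ acc h a q').Nonempty := by
  classical
  obtain ⟨b, hb, hmax⟩ := Finset.exists_max_image (Finset.univ.filter fun p => q' ∈ δ p a)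
    (fun p => bitKey (h p)) ⟨p, by simpa using hq⟩
  simp only [Finset.mem_filter, Finset.mem_univ, true_and] at hb hmax
  have hbne : (h b).Nonempty := by
    rcases bitKey_le (hmax p hq) with he | ⟨d, hd, -⟩
    · exact he ▸ hp
    · exact ⟨d, hd⟩
  have H : ∃ b, q' ∈ δ b a ∧ (h b).Nonempty ∧ ∀ p, q' ∈ δ p a → bitKey (h p) ≤ bitKey (h b) :=
    ⟨b, hb, hbne, hmax⟩
  rw [spawn, dif_pos H]
  exact H.choose_spec.2.1.mono Finset.subset_union_left

theorem sup_id_mem {X : Finset ℕ} (hX : X.Nonempty) : X.sup id ∈ X := by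
  obtain ⟨i, hi, h⟩ := Finset.exists_mem_eq_sup X hX id
  exact h ▸ hi

theorem TreeLike.spawn (ht : TreeLike h) (hlt : ∀ i, Occ h i → i < Fintype.card S) :
    TreeLike (spawn δ acc h a) := by
  intro q q' i hi hi' j hj hjq
  obtain ⟨b, -, hb, -, hs⟩ := spawn_spec ⟨i, hi⟩
  obtain ⟨b', -, hb', -, hs'⟩ := spawn_spec ⟨i, hi'⟩
  rw [hs] at hi hjq
  rw [hs'] at hi' ⊢
  rcases hi with hi | ⟨-, hi⟩ <;> rcases hi' with hi' | ⟨ha, hi'⟩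
  · have := hlt i ⟨b, hi⟩
    rcases hjq with hjq | ⟨-, hjq⟩
    · exact Or.inl (ht b b' i hi hi' j hj hjq)
    · omega
  · have := hlt i ⟨b, hi⟩
    omega
  · have := hlt i ⟨b', hi'⟩
    omega
  · have he : (h b).sup id = (h b').sup id := by omega
    rcases hjq with hjq | ⟨-, hjq⟩
    · exact Or.inl (ht b b' _ (sup_id_mem hb) (he ▸ sup_id_mem hb') j
        (Finset.le_sup (f := id) hjq) hjq)
    · exact Or.inr ⟨ha, hjq.trans (by rw [he])⟩

theorem Rooted.spawn (hr : Rooted h) : Rooted (spawn δ acc h a) := by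
  intro q i hi
  obtain ⟨b, -, ⟨j, hj⟩, -, hs⟩ := spawn_spec ⟨i, hi⟩
  exact (hs 0).2 (Or.inl (hr b j hj))

theorem ValidState.lt_card {x : (S → Finset ℕ) × ℕ} (hx : ValidState x) {i : ℕ}
    (hi : Occ x.1 i) : i < Fintype.card S := by
  obtain ⟨-, -, m, hm, hl, -⟩ := hx
  exact lt_of_lt_of_le ((hm i).1 hi) (card_le_of_forall_last hl)

theorem validState_step {x : (S → Finset ℕ) × ℕ} (hx : ValidState x) (a : A) :
    ValidState (compress (collapse (spawn δ acc x.1 a)), prio (spawn δ acc x.1 a)) := by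
  have ht := hx.1.spawn (δ := δ) (acc := acc) (a := a) fun i hi => hx.lt_card hi
  have hr := hx.2.1.spawn (δ := δ) (acc := acc) (a := a)
  set g := spawn δ acc x.1 a
  obtain ⟨K, hK⟩ := exists_not_occ (collapse g)
  refine ⟨ht.collapse.compress, hr.collapse.compress, colRank (collapse g) K, fun i => ?_,
    fun i hi => ?_, ?_⟩
  · constructor
    · rintro ⟨q, hq⟩
      obtain ⟨j, hj, rfl⟩ := mem_compress.1 hq
      exact colRank_lt ⟨q, hj⟩ (hK j ⟨q, hj⟩)
    · intro hi
      obtain ⟨j, -, ⟨q, hq⟩, rfl⟩ := exists_colRank_eq hi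
      exact ⟨q, mem_compress.2 ⟨j, hq, rfl⟩⟩
  · obtain ⟨j, -, hj, rfl⟩ := exists_colRank_eq hi
    obtain ⟨q, hq, hmax⟩ := exists_last_collapse ht hj
    refine ⟨q, mem_compress.2 ⟨j, hq, rfl⟩, fun y hy => ?_⟩
    obtain ⟨k, hk, rfl⟩ := mem_compress.1 hy
    rcases (hmax k hk).eq_or_lt with rfl | hlt
    · exact le_rfl
    · exact (colRank_lt ⟨q, hk⟩ hlt).le
  · have hgap : gap (collapse g) ≤ colRank (collapse g) K := by
      by_contra hlt
      have hlt := not_le.1 hlt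
      have := hK _ (occ_of_lt_gap hlt)
      have h2 := colRank_lt (occ_of_lt_gap hlt) this
      rw [colRank_eq_of_le_gap hlt.le] at h2
      omega
    rcases prio_eq_or g with ⟨f, hf, -, he⟩ | he <;> simp only [he] <;> omega

end Step

section LastColumn

variable {S : Type} {h : S → Finset ℕ}

/-- One more than the last column of `q`, or `0` if the label of `q` is empty. -/
def lastColumn (h : S → Finset ℕ) (q : S) : ℕ := (h q).sup Nat.succ

theorem lastColumn_eq_zero {q : S} : lastColumn h q = 0 ↔ h q = ∅ := by
  simp [lastColumn, Finset.eq_empty_iff_forall_notMem]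

theorem lastColumn_eq_succ {q : S} {i : ℕ} :
    lastColumn h q = i + 1 ↔ i ∈ h q ∧ ∀ j ∈ h q, j ≤ i := by
  constructor
  · intro he
    have hne : (h q).Nonempty := by
      by_contra hne
      have := lastColumn_eq_zero.2 (Finset.not_nonempty_iff_eq_empty.1 hne)
      omega
    obtain ⟨j, hj, hs⟩ := Finset.exists_mem_eq_sup _ hne Nat.succ
    have hji : j = i := by unfold lastColumn at he; omega
    refine ⟨hji ▸ hj, fun k hk => ?_⟩
    have : k.succ ≤ lastColumn h q := Finset.le_sup (f := Nat.succ) hk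
    omega
  · rintro ⟨hi, hmax⟩
    apply le_antisymm
    · exact Finset.sup_le fun j hj => Nat.succ_le_succ (hmax j hj)
    · exact Finset.le_sup (f := Nat.succ) hi

end LastColumn

section Counting

variable {S : Type} [Fintype S] {h h₁ h₂ : S → Finset ℕ}

/-- The column preceding `i` in the labels containing `i`. -/
def parentColumn (h : S → Finset ℕ) (i : ℕ) : ℕ :=
  Finset.univ.sup fun q => if i ∈ h q then ((h q).filter (· < i)).sup id else 0

theorem parentColumn_lt {i : ℕ} (hi : 0 < i) : parentColumn h i < i := by
  refine (Finset.sup_lt_iff (by simpa using hi)).2 fun q _ => ?_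
  split_ifs
  · exact (Finset.sup_lt_iff (by simpa using hi)).2 fun j hj => (Finset.mem_filter.1 hj).2
  · exact hi

theorem parentColumn_eq (ht : TreeLike h) {q : S} {i : ℕ} (hi : i ∈ h q) :
    parentColumn h i = ((h q).filter (· < i)).sup id := by
  apply le_antisymm
  · refine Finset.sup_le fun p _ => ?_
    split_ifs with hp
    · refine Finset.sup_mono fun j hj => ?_
      rw [Finset.mem_filter] at hj ⊢
      exact ⟨ht p q i hp hi j hj.2.le hj.1, hj.2⟩
    · exact Nat.zero_le _
  · have := Finset.le_sup (f := fun q => if i ∈ h q then ((h q).filter (· < i)).sup id else 0)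
      (Finset.mem_univ q)
    simp only [hi, if_true] at this
    exact this

theorem parentColumn_mem (ht : TreeLike h) (hr : Rooted h) {q : S} {i : ℕ} (hi : i ∈ h q)
    (h0 : 0 < i) : parentColumn h i ∈ h q := by
  rw [parentColumn_eq ht hi]
  have hne : ((h q).filter (· < i)).Nonempty := ⟨0, by simp [hr q i hi, h0]⟩
  exact (Finset.mem_filter.1 (sup_id_mem hne)).1

theorem le_parentColumn (ht : TreeLike h) {q : S} {i j : ℕ} (hi : i ∈ h q) (hj : j ∈ h q)
    (hji : j < i) : j ≤ parentColumn h i := by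
  rw [parentColumn_eq ht hi]
  exact Finset.le_sup (f := id) (Finset.mem_filter.2 ⟨hj, hji⟩)

theorem mem_of_parentColumn_eq (ht₁ : TreeLike h₁) (ht₂ : TreeLike h₂) (hr₁ : Rooted h₁)
    (hr₂ : Rooted h₂)
    (hp : ∀ i, Occ h₁ i → 0 < i → parentColumn h₁ i = parentColumn h₂ i) (q q' : S) (i : ℕ)
    (hi₁ : i ∈ h₁ q) (hi₂ : i ∈ h₂ q') (j : ℕ) (hji : j ≤ i) (hj : j ∈ h₁ q) : j ∈ h₂ q' := by
  induction i using Nat.strong_induction_on with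
  | _ i ih =>
    rcases hji.eq_or_lt with rfl | hlt
    · exact hi₂
    · have h0 : 0 < i := by omega
      have he := hp i ⟨q, hi₁⟩ h0
      exact ih (parentColumn h₁ i) (parentColumn_lt h0) (parentColumn_mem ht₁ hr₁ hi₁ h0)
        (he ▸ parentColumn_mem ht₂ hr₂ hi₂ h0) (le_parentColumn ht₁ hi₁ hj hlt)

theorem subset_of_codes_eq (ht₁ : TreeLike h₁) (ht₂ : TreeLike h₂) (hr₁ : Rooted h₁)
    (hr₂ : Rooted h₂) (hl : ∀ q, lastColumn h₁ q = lastColumn h₂ q)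
    (hp : ∀ i, Occ h₁ i → 0 < i → parentColumn h₁ i = parentColumn h₂ i) (q : S) :
    h₁ q ⊆ h₂ q := by
  intro j hj
  obtain ⟨i, hi⟩ : ∃ i, lastColumn h₁ q = i + 1 := by
    refine Nat.exists_eq_succ_of_ne_zero fun h0 => ?_
    simp [lastColumn_eq_zero.1 h0] at hj
  have h1 := lastColumn_eq_succ.1 hi
  have h2 := lastColumn_eq_succ.1 ((hl q).symm.trans hi)
  exact mem_of_parentColumn_eq ht₁ ht₂ hr₁ hr₂ hp q q i h1.1 h2.1 j (h1.2 j hj) hj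

theorem eq_of_codes_eq (ht₁ : TreeLike h₁) (ht₂ : TreeLike h₂) (hr₁ : Rooted h₁)
    (hr₂ : Rooted h₂) (hl : ∀ q, lastColumn h₁ q = lastColumn h₂ q) {m : ℕ}
    (hm₁ : ∀ i, Occ h₁ i → i < m) (hm₂ : ∀ i, Occ h₂ i → i < m)
    (hp : ∀ i, i + 1 < m → parentColumn h₁ (i + 1) = parentColumn h₂ (i + 1)) : h₁ = h₂ := by
  have hp' : ∀ i < m, 0 < i → parentColumn h₁ i = parentColumn h₂ i := by
    rintro (_ | i) hi h0
    · omega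
    · exact hp i hi
  funext q
  exact (subset_of_codes_eq ht₁ ht₂ hr₁ hr₂ hl (fun i hi => hp' i (hm₁ i hi)) q).antisymm
    (subset_of_codes_eq ht₂ ht₁ hr₂ hr₁ (fun q => (hl q).symm)
      (fun i hi h0 => (hp' i (hm₂ i hi) h0).symm) q)

/-- Codes for macrostates: the last columns and the parent columns, separated into the case of
at most `k + 1` inhabited columns and the case of `k + 2` inhabited columns. -/
abbrev Code (S : Type) (k : ℕ) : Type :=
  ((S → Fin (k + 2)) × (∀ i : Fin k, Fin (i + 1)) × Fin (2 * (k + 1))) ⊕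
    ((S ≃ Fin (k + 2)) × (∀ i : Fin (k + 1), Fin (i + 1)) × Fin (2 * (k + 2)))

theorem card_parents (k : ℕ) : Fintype.card (∀ i : Fin k, Fin (i + 1)) = k.factorial := by
  rw [Fintype.card_pi]
  simp only [Fintype.card_fin]
  rw [Fin.prod_univ_eq_prod_range (fun i => i + 1), Finset.prod_range_add_one_eq_factorial]

theorem factorial_succ_le_pow (k : ℕ) : (k + 1).factorial ≤ (k + 2) ^ k := by
  induction k with
  | zero => simp
  | succ k ih =>
    calc (k + 1 + 1).factorial = (k + 2) * (k + 1).factorial := Nat.factorial_succ (k + 1)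
      _ ≤ (k + 3) * (k + 3) ^ k :=
        Nat.mul_le_mul (by omega) (ih.trans (Nat.pow_le_pow_left (by omega) k))
      _ = (k + 1 + 2) ^ (k + 1) := (pow_succ' _ _).symm

open Classical in
theorem card_code {k : ℕ} (hS : Fintype.card S = k + 2) :
    Fintype.card (Code S k) ≤ 2 * (k + 2) ^ (k + 2) * (k + 2).factorial := by
  have e : S ≃ Fin (k + 2) := Fintype.equivFinOfCardEq hS
  rw [Fintype.card_sum, Fintype.card_prod, Fintype.card_prod, Fintype.card_prod,
    Fintype.card_prod, card_parents, card_parents, Fintype.card_fun, Fintype.card_equiv e]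
  simp only [Fintype.card_fin, hS]
  have hfac : (k + 2).factorial ≤ (k + 2) ^ (k + 1) := by
    rw [Nat.factorial_succ, pow_succ, mul_comm]
    exact Nat.mul_le_mul_right _ (factorial_succ_le_pow k)
  have h1 : (k + 1).factorial = (k + 1) * k.factorial := Nat.factorial_succ k
  have h2 : (k + 2).factorial = (k + 2) * (k + 1).factorial := Nat.factorial_succ (k + 1)
  have h3 : (k + 2) ^ (k + 2) = (k + 2) ^ (k + 1) * (k + 2) := pow_succ _ _
  calc (k + 2) ^ (k + 2) * (k.factorial * (2 * (k + 1))) +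
        (k + 2).factorial * ((k + 1).factorial * (2 * (k + 2)))
      = 2 * (k + 1).factorial * ((k + 2) ^ (k + 2) + (k + 2) * (k + 2).factorial) := by
        rw [h1]; ring
    _ ≤ 2 * (k + 1).factorial * ((k + 2) ^ (k + 2) + (k + 2) * (k + 2) ^ (k + 1)) := by gcongr
    _ = 2 * (k + 1).factorial * (2 * (k + 2) ^ (k + 2)) := by rw [h3]; ring
    _ ≤ 2 * (k + 1).factorial * ((k + 2) * (k + 2) ^ (k + 2)) := by gcongr; omega
    _ = 2 * (k + 2) ^ (k + 2) * (k + 2).factorial := by rw [h2]; ring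

theorem exists_code {k : ℕ} (hS : Fintype.card S = k + 2) :
    ∃ f : {x : (S → Finset ℕ) × ℕ // ValidState x} → Code S k, Function.Injective f := by
  let P : {x : (S → Finset ℕ) × ℕ // ValidState x} → Code S k → Prop := fun x c =>
    match c with
    | .inl c => (∀ q, lastColumn x.1.1 q = c.1 q) ∧
        (∀ i : Fin _, parentColumn x.1.1 (i + 1) = c.2.1 i) ∧ x.1.2 = c.2.2 ∧
        ∀ i, Occ x.1.1 i → i < k + 1
    | .inr c => (∀ q, lastColumn x.1.1 q = c.1 q + 1) ∧
        (∀ i : Fin _, parentColumn x.1.1 (i + 1) = c.2.1 i) ∧ x.1.2 = c.2.2 ∧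
        ∀ i, Occ x.1.1 i → i < k + 2
  have hex : ∀ x, ∃ c, P x c := by
    rintro ⟨⟨h, p⟩, hx⟩
    obtain ⟨ht, hr, m, hm, hl, hp⟩ := id hx
    have hmS := card_le_of_forall_last hl
    have hle : ∀ q, lastColumn h q ≤ m := fun q =>
      Finset.sup_le fun i hi => (hm i).1 ⟨q, hi⟩
    simp only at hp
    by_cases hmk : m ≤ k + 1
    · exact ⟨.inl ⟨fun q => ⟨lastColumn h q, by have := hle q; omega⟩,
        fun i => ⟨parentColumn h (i + 1), parentColumn_lt (by omega)⟩, ⟨p, by omega⟩⟩,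
        fun _ => rfl, fun _ => rfl, rfl, fun i hi => ((hm i).1 hi).trans_le hmk⟩
    · obtain rfl : m = k + 2 := by omega
      have hsurj : ∀ i : Fin (k + 2), ∃ q, lastColumn h q = i + 1 := fun i =>
        (hl i i.2).imp fun q hq => lastColumn_eq_succ.2 hq
      choose f hf using hsurj
      have hinj : Function.Injective f := fun i j hij => by
        have h1 := hf i
        have h2 := hf j
        rw [hij] at h1
        exact Fin.ext (by omega)
      have hbij : Function.Bijective f :=
        (Fintype.bijective_iff_injective_and_card f).2 ⟨hinj, by simp [hS]⟩
      refine ⟨.inr ⟨(Equiv.ofBijective f hbij).symm,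
        fun i => ⟨parentColumn h (i + 1), parentColumn_lt (by omega)⟩, ⟨p, by omega⟩⟩,
        fun q => ?_, fun _ => rfl, rfl, fun i hi => (hm i).1 hi⟩
      have := hf ((Equiv.ofBijective f hbij).symm q)
      rwa [Equiv.ofBijective_apply_symm_apply f hbij q] at this
  choose f hf using hex
  refine ⟨f, fun x y hxy => ?_⟩
  have h1 := hf x
  have h2 := hf y
  rw [hxy] at h1
  generalize f y = c at h1 h2
  apply Subtype.ext
  obtain ⟨htx, hrx, -⟩ := x.2
  obtain ⟨hty, hry, -⟩ := y.2
  rcases c with c | c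
  · refine Prod.ext (eq_of_codes_eq htx hty hrx hry (fun q => ?_) h1.2.2.2 h2.2.2.2
      fun i hi => ?_) (h1.2.2.1.trans h2.2.2.1.symm)
    · exact (h1.1 q).trans (h2.1 q).symm
    · exact (h1.2.1 ⟨i, by omega⟩).trans (h2.2.1 ⟨i, by omega⟩).symm
  · refine Prod.ext (eq_of_codes_eq htx hty hrx hry (fun q => ?_) h1.2.2.2 h2.2.2.2
      fun i hi => ?_) (h1.2.2.1.trans h2.2.2.1.symm)
    · exact (h1.1 q).trans (h2.1 q).symm
    · exact (h1.2.1 ⟨i, by omega⟩).trans (h2.2.1 ⟨i, by omega⟩).symm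

end Counting

/-- König's lemma for layered finite graphs in which paths can be extended backwards. -/
theorem exists_path_of_backward {S : Type} [Finite S] (F : ℕ → Set S) (R : ℕ → S → S → Prop)
    (hne : ∀ N, ∃ t, N ≤ t ∧ (F t).Nonempty)
    (hback : ∀ t, ∀ q' ∈ F (t + 1), ∃ q ∈ F t, R t q q') :
    ∃ r : ℕ → S, ∀ t, r t ∈ F t ∧ R t (r t) (r (t + 1)) := by
  let _ : TopologicalSpace S := ⊥
  have : DiscreteTopology S := ⟨rfl⟩
  let K : ℕ → Set (ℕ → S) := fun N => {r | ∀ t < N, r t ∈ F t ∧ R t (r t) (r (t + 1))}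
  have hpath : ∀ N, ∀ q ∈ F N, ∃ r : ℕ → S, r N = q ∧ r ∈ K N := by
    intro N
    induction N with
    | zero => exact fun q _ => ⟨fun _ => q, rfl, fun t ht => absurd ht (by omega)⟩
    | succ N ih =>
      intro q' hq'
      obtain ⟨q, hq, hR⟩ := hback N q' hq'
      obtain ⟨r, hr, hK⟩ := ih q hq
      refine ⟨Function.update r (N + 1) q', by simp, fun t ht => ?_⟩
      rw [Function.update_of_ne (by omega)]
      rcases Nat.lt_succ_iff_lt_or_eq.1 ht with ht | rfl
      · rw [Function.update_of_ne (by omega)]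
        exact hK t ht
      · rw [Function.update_self, hr]
        exact ⟨hq, hR⟩
  have hclosed : ∀ N, IsClosed (K N) := by
    intro N
    have : K N = ⋂ t, ⋂ (_ : t < N),
        (fun r : ℕ → S => (r t, r (t + 1))) ⁻¹' {p | p.1 ∈ F t ∧ R t p.1 p.2} := by
      ext r
      simp [K]
    rw [this]
    exact isClosed_iInter fun t => isClosed_iInter fun _ =>
      (isClosed_discrete _).preimage (by fun_prop)
  obtain ⟨r, hr⟩ := IsCompact.nonempty_iInter_of_sequence_nonempty_isCompact_isClosed K
    (fun N r hr t ht => hr t (by omega))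
    (fun N => by
      obtain ⟨t, ht, q, hq⟩ := hne N
      obtain ⟨r, -, hr⟩ := hpath t q hq
      exact ⟨r, fun s hs => hr s (by omega)⟩)
    (hclosed 0).isCompact hclosed
  exact ⟨r, fun t => Set.mem_iInter.1 hr (t + 1) t (by omega)⟩

section Correctness

variable {A S : Type} [Fintype S] {δ : S → A → Set S} {acc : Set S}

theorem exists_pred_of_nonempty {h : S → Finset ℕ} {a : A} {q' : S}
    (hq : (compress (collapse (spawn δ acc h a)) q').Nonempty) :
    ∃ b, q' ∈ δ b a ∧ (h b).Nonempty := by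
  obtain ⟨x, hx⟩ := hq
  obtain ⟨i, hi, -⟩ := mem_compress.1 hx
  obtain ⟨b, hb, hne, -⟩ := spawn_spec ⟨i, (mem_collapse.1 hi).1⟩
  exact ⟨b, hb, hne⟩

/-- Every state in a persistent column `f` has a predecessor in that column; it can only
enter a column below `f` by visiting the acceptance set. -/
theorem exists_pred_of_mem {h : S → Finset ℕ} {a : A} {q' : S} {f : ℕ}
    (hf : f < Fintype.card S) (hgap : f < gap (collapse (spawn δ acc h a)))
    (hq : f ∈ compress (collapse (spawn δ acc h a)) q') :
    ∃ b, q' ∈ δ b a ∧ f ∈ h b ∧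
      ((∃ j ∈ compress (collapse (spawn δ acc h a)) q', f < j) →
        (∃ j ∈ h b, f < j) ∨ q' ∈ acc) ∧
      (Green (spawn δ acc h a) f → ((∃ j ∈ h b, f < j) ∨ q' ∈ acc) ∧
        ¬ ∃ j ∈ compress (collapse (spawn δ acc h a)) q', f < j) := by
  have hfc := (mem_compress_of_lt_gap hgap).1 hq
  have hfg := (mem_collapse.1 hfc).1
  obtain ⟨b, hb, hne, -, hs⟩ := spawn_spec ⟨f, hfg⟩
  have hlater : ∀ j ∈ spawn δ acc h a q', f < j → (∃ j ∈ h b, f < j) ∨ q' ∈ acc := by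
    intro j hj hfj
    rcases (hs j).1 hj with hj | hj
    · exact Or.inl ⟨j, hj, hfj⟩
    · exact Or.inr hj.1
  have hcomp : ∀ j ∈ compress (collapse (spawn δ acc h a)) q', f < j →
      ∃ i ∈ collapse (spawn δ acc h a) q', f < i := by
    intro j hj hfj
    obtain ⟨i, hi, rfl⟩ := mem_compress.1 hj
    exact ⟨i, hi, hfj.trans_le (colRank_le i)⟩
  refine ⟨b, hb, ?_, ?_, fun hG => ⟨?_, ?_⟩⟩
  · rcases (hs f).1 hfg with h' | h'
    · exact h'
    · omega
  · rintro ⟨j, hj, hfj⟩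
    obtain ⟨i, hi, hfi⟩ := hcomp j hj hfj
    exact hlater i (mem_collapse.1 hi).1 hfi
  · obtain ⟨j, hj, hfj⟩ := hG.2 q' hfg
    exact hlater j hj hfj
  · rintro ⟨j, hj, hfj⟩
    obtain ⟨i, hi, hfi⟩ := hcomp j hj hfj
    exact (mem_collapse.1 hi).2 f hfg hfi hG

variable {s0 : S} {w : ℕ → A} {h : ℕ → S → Finset ℕ}

/-- A column that persists and is green infinitely often yields an accepting run. -/
theorem mem_buchiLang_of_green (h0 : ∀ q, (h 0 q).Nonempty → q = s0)
    (hs : ∀ t, h (t + 1) = compress (collapse (spawn δ acc (h t) (w t)))) {f T : ℕ}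
    (hf : f < Fintype.card S)
    (hgap : ∀ t, T ≤ t → f < gap (collapse (spawn δ acc (h t) (w t))))
    (hgreen : ∃ᶠ t in Filter.atTop, Green (spawn δ acc (h t) (w t)) f) :
    ∃ r, IsRun δ s0 w r ∧ ∃ᶠ t in Filter.atTop, r t ∈ acc := by
  obtain ⟨r, hr⟩ := exists_path_of_backward
    (fun t => {q | (h t q).Nonempty ∧ (T < t → f ∈ h t q)})
    (fun t q q' => q' ∈ δ q (w t) ∧ (T < t →
      ((∃ j ∈ h (t + 1) q', f < j) → (∃ j ∈ h t q, f < j) ∨ q' ∈ acc) ∧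
      (Green (spawn δ acc (h t) (w t)) f →
        ((∃ j ∈ h t q, f < j) ∨ q' ∈ acc) ∧ ¬ ∃ j ∈ h (t + 1) q', f < j)))
    (fun N => by
      have hg := hgap (max N T) (le_max_right _ _)
      obtain ⟨q, hq⟩ := occ_of_lt_gap hg
      have hq := (mem_compress_of_lt_gap hg).2 hq
      rw [← hs] at hq
      exact ⟨max N T + 1, by omega, q, ⟨f, hq⟩, fun _ => hq⟩)
    (fun t q' hq' => by
      by_cases hT : T ≤ t
      · have hq := hq'.2 (by omega)
        rw [hs] at hq
        obtain ⟨b, hb, hfb, hrest⟩ := exists_pred_of_mem hf (hgap t hT) hq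
        rw [← hs] at hrest
        exact ⟨b, ⟨⟨f, hfb⟩, fun _ => hfb⟩, hb, fun _ => hrest⟩
      · have hq := hq'.1
        rw [hs] at hq
        obtain ⟨b, hb, hne⟩ := exists_pred_of_nonempty hq
        exact ⟨b, ⟨hne, fun hlt => absurd hlt (by omega)⟩, hb, fun hlt => absurd hlt (by omega)⟩)
  refine ⟨r, ⟨h0 _ (hr 0).1.1, fun t => (hr t).2.1⟩, ?_⟩
  by_contra hcon
  rw [Filter.not_frequently] at hcon
  obtain ⟨N, hN⟩ := Filter.eventually_atTop.1 hcon
  rw [Filter.frequently_atTop] at hgreen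
  obtain ⟨t₁, ht₁, hG₁⟩ := hgreen (max N (T + 1))
  have hclean : ∀ t, t₁ + 1 ≤ t → ¬ ∃ j ∈ h t (r t), f < j := by
    intro t ht
    induction t, ht using Nat.le_induction with
    | base => exact (((hr t₁).2.2 (by omega)).2 hG₁).2
    | succ t ht ih =>
      intro hD
      rcases ((hr t).2.2 (by omega)).1 hD with h' | h'
      · exact ih h'
      · exact hN (t + 1) (by omega) h'
  obtain ⟨t₂, ht₂, hG₂⟩ := hgreen (t₁ + 1)
  rcases (((hr t₂).2.2 (by omega)).2 hG₂).1 with h' | h'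
  · exact hclean t₂ ht₂ h'
  · exact hN (t₂ + 1) (by omega) h'

/-- If column `i` persists and is not green, the first column after `i` in the label of a run
does not increase, and it persists if it keeps its name. -/
theorem exists_next_column {h : S → Finset ℕ} {a : A} {q q' : S} {i : ℕ} (hq : q' ∈ δ q a)
    (hi : i ∈ h q) (hic : i < Fintype.card S) (hgap : i < gap (collapse (spawn δ acc h a)))
    (hi' : i ∈ compress (collapse (spawn δ acc h a)) q')
    (hP : (compress (collapse (spawn δ acc h a)) q').filter (· ≤ i) = (h q).filter (· ≤ i))
    (hG : ¬ Green (spawn δ acc h a) i) :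
    (q' ∈ acc → ∃ j ∈ compress (collapse (spawn δ acc h a)) q', i < j) ∧
    ∀ v ∈ h q, i < v → ∃ v' ∈ compress (collapse (spawn δ acc h a)) q', i < v' ∧ v' ≤ v ∧
      (v' = v → v < gap (collapse (spawn δ acc h a))) := by
  have hpre : ∀ j ≤ i, (j ∈ compress (collapse (spawn δ acc h a)) q' ↔ j ∈ h q) := by
    intro j hj
    have := Finset.ext_iff.1 hP j
    simpa [hj] using this
  have hic' := (mem_compress_of_lt_gap hgap).1 hi'
  obtain ⟨hig, hnog⟩ := mem_collapse.1 hic'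
  obtain ⟨b, hb, -, hmax, hs⟩ := spawn_spec ⟨i, hig⟩
  have hfirst : ∀ v, (∃ j ∈ spawn δ acc h a q', i < j ∧ j ≤ v) →
      ∃ v' ∈ compress (collapse (spawn δ acc h a)) q', i < v' ∧ v' ≤ v ∧
        (v' = v → v < gap (collapse (spawn δ acc h a))) := by
    rintro v ⟨j, hj, hij, hjv⟩
    obtain ⟨u, ⟨hu, hiu⟩, humin⟩ :=
      WellFounded.has_min (wellFounded_lt (α := ℕ)) {u | u ∈ spawn δ acc h a q' ∧ i < u}
        ⟨j, hj, hij⟩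
    have huj : u ≤ j := not_lt.1 (humin j ⟨hj, hij⟩)
    have huc : u ∈ collapse (spawn δ acc h a) q' := by
      refine mem_collapse.2 ⟨hu, fun k hk hku => ?_⟩
      rcases lt_trichotomy k i with hki | rfl | hki
      · exact hnog k hk hki
      · exact hG
      · exact absurd hku (humin k ⟨hk, hki⟩)
    refine ⟨_, mem_compress.2 ⟨u, huc, rfl⟩, ?_, (colRank_le u).trans (huj.trans hjv), ?_⟩
    · exact (colRank_eq_of_le_gap hgap.le).symm.trans_lt (colRank_lt ⟨q', hic'⟩ hiu)
    · intro he
      have hle := colRank_le (g := collapse (spawn δ acc h a)) u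
      obtain rfl : u = v := by omega
      refine lt_gap_of_forall fun k hk => ?_
      rcases hk.eq_or_lt with rfl | hk
      · exact ⟨q', huc⟩
      · exact occ_of_colRank_eq he hk
  constructor
  · intro hacc
    obtain ⟨v', hv', hiv, -⟩ := hfirst _ ⟨_, (hs _).2 (Or.inr ⟨hacc, rfl⟩), by omega, le_rfl⟩
    exact ⟨v', hv', hiv⟩
  · intro v hv hiv
    apply hfirst
    rcases bitKey_le (hmax q hq) with he | ⟨d, hd, hdq, hdeq⟩
    · exact ⟨v, (hs v).2 (Or.inl (he ▸ hv)), hiv, le_rfl⟩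
    · by_cases hdv : d ≤ v
      · refine ⟨d, (hs d).2 (Or.inl hd), ?_, hdv⟩
        by_contra hdi
        have hdi := not_lt.1 hdi
        refine hdq ((hpre d hdi).1 ((mem_compress_of_lt_gap (by omega)).2
          (mem_collapse.2 ⟨(hs d).2 (Or.inl hd), fun k hk hkd => hnog k hk (by omega)⟩)))
      · exact ⟨v, (hs v).2 (Or.inl ((hdeq v (by omega)).1 hv)), hiv, le_rfl⟩

/-- An accepting run yields a persistent column that is green infinitely often. -/
theorem exists_green_of_run (h0 : (h 0 s0).Nonempty)
    (hs : ∀ t, h (t + 1) = compress (collapse (spawn δ acc (h t) (w t))))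
    (hroot : ∀ t, Rooted (h t)) (hlt : ∀ t i, Occ (h t) i → i < Fintype.card S)
    {r : ℕ → S} (hr : IsRun δ s0 w r) (hacc : ∃ᶠ t in Filter.atTop, r t ∈ acc) :
    ∃ f T, (∀ t, T ≤ t → f < gap (collapse (spawn δ acc (h t) (w t)))) ∧
      ∃ᶠ t in Filter.atTop, Green (spawn δ acc (h t) (w t)) f := by
  have hne : ∀ t, (h t (r t)).Nonempty := by
    intro t
    induction t with
    | zero => rw [hr.1]; exact h0
    | succ t ih =>
      obtain ⟨i, hi⟩ := spawn_nonempty (acc := acc) ih (hr.2 t)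
      have h0 := (hroot t).spawn (δ := δ) (acc := acc) (a := w t) (r (t + 1)) i hi
      rw [hs]
      exact ⟨_, mem_compress.2 ⟨0, mem_collapse.2 ⟨h0, by simp⟩, rfl⟩⟩
  have h0mem : ∀ t, 0 ∈ h t (r t) := fun t => (hne t).elim fun i hi => hroot t _ i hi
  have h0gap : ∀ t, 0 < gap (collapse (spawn δ acc (h t) (w t))) := by
    intro t
    have := h0mem (t + 1)
    rw [hs] at this
    obtain ⟨i, hi, -⟩ := mem_compress.1 this
    refine lt_gap_of_forall fun j hj => ⟨r (t + 1), ?_⟩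
    obtain rfl : j = 0 := by omega
    exact (hroot t).spawn.collapse _ i hi
  by_contra hcon
  push Not at hcon
  let C : ℕ → Prop := fun i => ∃ T P, ∀ t, T ≤ t → i ∈ h t (r t) ∧
    (h t (r t)).filter (· ≤ i) = P ∧ i < gap (collapse (spawn δ acc (h t) (w t)))
  have hC0 : C 0 := by
    refine ⟨0, {0}, fun t _ => ⟨h0mem t, ?_, h0gap t⟩⟩
    ext j
    have := h0mem t
    simp only [Finset.mem_filter, Finset.mem_singleton, Nat.le_zero]
    exact ⟨fun h => h.2, fun h => ⟨h ▸ this, h⟩⟩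
  have hstep : ∀ i, C i → ∃ i', i < i' ∧ C i' := by
    rintro i ⟨T, P, hT⟩
    have hic : i < Fintype.card S := hlt T i ⟨_, (hT T le_rfl).1⟩
    have hgreen := hcon i T fun t ht => (hT t ht).2.2
    obtain ⟨N, hN⟩ := Filter.eventually_atTop.1 hgreen
    have hnext : ∀ t, max T N ≤ t → _ := fun t ht => by
      have h1 := hT t (by omega)
      have h2 := hT (t + 1) (by omega)
      rw [hs] at h2
      exact exists_next_column (hr.2 t) h1.1 hic h1.2.2 h2.1 (h2.2.1.trans h1.2.1.symm)
        (hN t (by omega))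
    have hex : ∃ v, ∃ t, max T N ≤ t ∧ v ∈ h t (r t) ∧ i < v := by
      rw [Filter.frequently_atTop] at hacc
      obtain ⟨t, ht, hta⟩ := hacc (max T N + 1)
      obtain ⟨t, rfl⟩ : ∃ s, t = s + 1 := ⟨t - 1, by omega⟩
      obtain ⟨j, hj, hij⟩ := (hnext t (by omega)).1 hta
      rw [← hs] at hj
      exact ⟨j, t + 1, by omega, hj, hij⟩
    classical
    obtain ⟨t₂, ht₂, hv₂, hiv⟩ := Nat.find_spec hex
    have hmin : ∀ t, max T N ≤ t → ∀ u ∈ h t (r t), i < u → Nat.find hex ≤ u :=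
      fun t ht u hu hiu => Nat.find_min' hex ⟨t, ht, hu, hiu⟩
    generalize Nat.find hex = v at hv₂ hiv hmin
    have hkeep : ∀ t, max T N ≤ t → v ∈ h t (r t) → v ∈ h (t + 1) (r (t + 1)) ∧
        v < gap (collapse (spawn δ acc (h t) (w t))) := by
      intro t ht hv
      obtain ⟨v', hv', hiv', hle, hgap⟩ := (hnext t ht).2 v hv hiv
      rw [← hs] at hv'
      obtain rfl : v' = v := le_antisymm hle (hmin (t + 1) (by omega) v' hv' hiv')
      exact ⟨hv', hgap rfl⟩
    have hmem : ∀ t, t₂ ≤ t → v ∈ h t (r t) := by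
      intro t ht
      induction t, ht using Nat.le_induction with
      | base => exact hv₂
      | succ t ht ih => exact (hkeep t (by omega) ih).1
    refine ⟨v, hiv, t₂, insert v P, fun t ht => ⟨hmem t ht, ?_, (hkeep t (by omega)
      (hmem t ht)).2⟩⟩
    ext j
    rw [← (hT t (by omega)).2.1]
    simp only [Finset.mem_filter, Finset.mem_insert]
    constructor
    · rintro ⟨hj, hjv⟩
      by_cases hji : j ≤ i
      · exact Or.inr ⟨hj, hji⟩
      · exact Or.inl (le_antisymm hjv (hmin t (by omega) j hj (by omega)))
    · rintro (rfl | ⟨hj, hji⟩)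
      · exact ⟨hmem t ht, le_rfl⟩
      · exact ⟨hj, by omega⟩
  have hall : ∀ k, ∃ i, k ≤ i ∧ C i := by
    intro k
    induction k with
    | zero => exact ⟨0, le_rfl, hC0⟩
    | succ k ih =>
      obtain ⟨i, hki, hCi⟩ := ih
      obtain ⟨i', hii', hCi'⟩ := hstep i hCi
      exact ⟨i', by omega, hCi'⟩
  obtain ⟨i, hi, T, P, hT⟩ := hall (Fintype.card S)
  exact absurd (hlt T i ⟨_, (hT T le_rfl).1⟩) (by omega)

/-- The priorities satisfy the parity condition iff the word is accepted. -/
theorem parity_prio_iff (h0 : ∀ q, (h 0 q).Nonempty ↔ q = s0)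
    (hs : ∀ t, h (t + 1) = compress (collapse (spawn δ acc (h t) (w t))))
    (hroot : ∀ t, Rooted (h t)) (hlt : ∀ t i, Occ (h t) i → i < Fintype.card S) :
    (∃ i, Even i ∧ (∃ᶠ t in Filter.atTop, prio (spawn δ acc (h t) (w t)) = i) ∧
      ∀ j < i, ¬ ∃ᶠ t in Filter.atTop, prio (spawn δ acc (h t) (w t)) = j) ↔
    ∃ r, IsRun δ s0 w r ∧ ∃ᶠ t in Filter.atTop, r t ∈ acc := by
  constructor
  · rintro ⟨i, ⟨f, rfl⟩, hfreq, hmin⟩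
    have hgreen : ∀ t, prio (spawn δ acc (h t) (w t)) = f + f →
        f < gap (collapse (spawn δ acc (h t) (w t))) ∧ Green (spawn δ acc (h t) (w t)) f := by
      intro t ht
      rcases prio_eq_or (spawn δ acc (h t) (w t)) with ⟨f', hf', hG, he⟩ | he
      · obtain rfl : f' = f := by omega
        exact ⟨hf', hG⟩
      · omega
    have hocc : ∀ t, f < gap (collapse (spawn δ acc (h t) (w t))) → Occ (h (t + 1)) f := by
      intro t ht
      obtain ⟨q, hq⟩ := occ_of_lt_gap ht
      rw [hs]
      exact ⟨q, (mem_compress_of_lt_gap ht).2 hq⟩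
    have hlive : ∀ t, ∃ q, (h t q).Nonempty := by
      intro t
      obtain ⟨t', ht', hp⟩ := Filter.frequently_atTop.1 hfreq t
      obtain ⟨q, hq⟩ := hocc t' (hgreen t' hp).1
      have hback : ∀ s, (∃ q, (h (s + 1) q).Nonempty) → ∃ q, (h s q).Nonempty := by
        rintro s ⟨q, hq⟩
        rw [hs] at hq
        obtain ⟨b, -, hb⟩ := exists_pred_of_nonempty hq
        exact ⟨b, hb⟩
      exact Nat.decreasingInduction (motive := fun s _ => ∃ q, (h s q).Nonempty)
        (fun s _ => hback s) ⟨q, f, hq⟩ (show t ≤ t' + 1 by omega)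
    have hpos : ∀ t, 0 < gap (collapse (spawn δ acc (h t) (w t))) := by
      intro t
      obtain ⟨q, x, hx⟩ := hlive (t + 1)
      rw [hs] at hx
      obtain ⟨i, hi, -⟩ := mem_compress.1 hx
      refine lt_gap_of_forall fun j hj => ⟨q, ?_⟩
      obtain rfl : j = 0 := by omega
      exact (hroot t).spawn.collapse _ i hi
    have hev : ∀ᶠ t in Filter.atTop, ∀ j ∈ Finset.range (f + f),
        prio (spawn δ acc (h t) (w t)) ≠ j := by
      rw [Filter.eventually_all_finset]
      exact fun j hj => Filter.not_frequently.1 (hmin j (Finset.mem_range.1 hj))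
    obtain ⟨T, hT⟩ := Filter.eventually_atTop.1 hev
    have hgap : ∀ t, T ≤ t → f < gap (collapse (spawn δ acc (h t) (w t))) := by
      intro t ht
      have h1 : f + f ≤ prio (spawn δ acc (h t) (w t)) := by
        by_contra hlt
        exact hT t ht _ (Finset.mem_range.2 (not_le.1 hlt)) rfl
      have h2 := hpos t
      rcases prio_eq_or (spawn δ acc (h t) (w t)) with ⟨f', hf', hG, he⟩ | he <;> omega
    exact mem_buchiLang_of_green (fun q => (h0 q).1) hs
      (hlt _ _ (hocc T (hgap T le_rfl))) hgap (hfreq.mono fun t ht => (hgreen t ht).2)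
  · rintro ⟨r, hr, hacc⟩
    obtain ⟨f, T, hgap, hgreen⟩ := exists_green_of_run ((h0 s0).2 rfl) hs hroot hlt hr hacc
    have hex : ∃ i, ∃ᶠ t in Filter.atTop, prio (spawn δ acc (h t) (w t)) = i ∧ i ≤ 2 * f := by
      have h1 : ∃ᶠ t in Filter.atTop, ∃ i ∈ Finset.range (2 * f + 1),
          prio (spawn δ acc (h t) (w t)) = i := by
        refine (hgreen.and_eventually (Filter.eventually_ge_atTop T)).mono ?_
        rintro t ⟨hG, ht⟩
        obtain ⟨f', hf', he⟩ := prio_of_green (hgap t ht) hG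
        exact ⟨2 * f', Finset.mem_range.2 (by omega), he⟩
      by_contra hcon
      push Not at hcon
      refine h1 ?_
      have : ∀ᶠ t in Filter.atTop, ∀ i ∈ Finset.range (2 * f + 1),
          ¬ prio (spawn δ acc (h t) (w t)) = i := by
        rw [Filter.eventually_all_finset]
        intro i hi
        refine (hcon i).mono fun t ht he => ?_
        have := ht he
        rw [Finset.mem_range] at hi
        omega
      exact this.mono fun t ht ⟨i, hi, he⟩ => ht i hi he
    classical
    have hspec := Nat.find_spec hex
    have hle : Nat.find hex ≤ 2 * f := hspec.exists.choose_spec.2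
    refine ⟨Nat.find hex, ?_, hspec.mono fun t ht => ht.1, fun j hj hfreq => ?_⟩
    · obtain ⟨t, ⟨he, -⟩, ht⟩ := (hspec.and_eventually (Filter.eventually_ge_atTop T)).exists
      have h2 := hgap t ht
      rcases prio_eq_or (spawn δ acc (h t) (w t)) with ⟨f', hf', hG, he'⟩ | he'
      · exact ⟨f', by omega⟩
      · omega
    · exact Nat.find_min hex hj (hfreq.mono fun t ht => ⟨ht, by omega⟩)

end Correctness

theorem infOcc_inter_nonempty_iff {T : Type} [Finite T] (r : ℕ → T) (F : Set T) :
    (InfOcc r ∩ F).Nonempty ↔ ∃ᶠ t in Filter.atTop, r t ∈ F := by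
  constructor
  · rintro ⟨s, hs, hF⟩
    rw [Filter.frequently_atTop]
    intro N
    obtain ⟨t, ht, rfl⟩ := hs N
    exact ⟨t, ht, hF⟩
  · intro h
    by_contra hcon
    have hev : ∀ s : T, ∀ᶠ t in Filter.atTop, r t = s → s ∉ F := by
      intro s
      by_cases hsF : s ∈ F
      · have : s ∉ InfOcc r := fun hs => hcon ⟨s, hs, hsF⟩
        simp only [InfOcc, Set.mem_ofPred_eq, not_forall, not_exists, not_and] at this
        obtain ⟨N, hN⟩ := this
        filter_upwards [Filter.eventually_ge_atTop N] with t ht he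
        exact absurd he (hN t ht)
      · exact Filter.Eventually.of_forall fun t _ => hsF
    rw [← Filter.eventually_all] at hev
    exact h (hev.mono fun t ht => ht (r t) rfl)

theorem mem_buchiLang_iff {A S : Type} [Finite S] {δ : S → A → Set S} {s0 : S} {acc : Set S}
    {w : ℕ → A} : w ∈ BuchiLang δ s0 acc ↔
      ∃ r, IsRun δ s0 w r ∧ ∃ᶠ t in Filter.atTop, r t ∈ acc := by
  simp only [BuchiLang, Set.mem_ofPred_eq, infOcc_inter_nonempty_iff]

/-- The parity condition in terms of a priority function. -/
theorem parityAccept_iff {T : Type} [Finite T] {k : ℕ} (p : T → ℕ) (hp : ∀ x, p x < k)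
    (r : ℕ → T) :
    ParityAccept (fun i : Fin k => {x | p x = i}) r ↔
      ∃ i, Even i ∧ (∃ᶠ t in Filter.atTop, p (r t) = i) ∧
        ∀ j < i, ¬ ∃ᶠ t in Filter.atTop, p (r t) = j := by
  simp only [ParityAccept, ← Set.not_nonempty_iff_eq_empty, infOcc_inter_nonempty_iff,
    Set.mem_ofPred_eq]
  constructor
  · rintro ⟨i, hi, hfreq, hmin⟩
    exact ⟨i, hi, hfreq, fun j hj => hmin ⟨j, by omega⟩ hj⟩
  · rintro ⟨i, hi, hfreq, hmin⟩
    obtain ⟨t, ht⟩ := hfreq.exists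
    exact ⟨⟨i, ht ▸ hp _⟩, hi, hfreq, fun j hj => hmin j hj⟩

theorem isPartition_priority {T : Type} {k : ℕ} (p : T → ℕ) (hp : ∀ x, p x < k) :
    IsPartition (fun i : Fin k => {x | p x = i}) := by
  constructor
  · intro i j hij
    ext x
    simp only [Set.mem_inter_iff, Set.mem_ofPred_eq, Set.mem_empty_iff_false, iff_false, not_and]
    exact fun hi hj => hij (Fin.ext (hi.symm.trans hj))
  · ext x
    simpa using ⟨⟨p x, hp x⟩, rfl⟩

theorem frequently_atTop_succ {p : ℕ → Prop} :
    (∃ᶠ t in Filter.atTop, p (t + 1)) ↔ ∃ᶠ t in Filter.atTop, p t := by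
  conv_rhs => rw [← Filter.map_add_atTop_eq_nat 1, Filter.frequently_map]

theorem ValidState.prio_lt {S : Type} [Fintype S] [Nonempty S] {x : (S → Finset ℕ) × ℕ}
    (hx : ValidState x) : x.2 < 2 * Fintype.card S := by
  obtain ⟨-, -, m, -, hl, hp⟩ := hx
  have := card_le_of_forall_last hl
  have := Fintype.card_pos (α := S)
  omega

open Classical in
theorem validState_init {S : Type} [Fintype S] (s0 : S) :
    ValidState ((fun q => if q = s0 then {0} else ∅, 1) : (S → Finset ℕ) × ℕ) := by
  have hmem : ∀ q i, i ∈ (if q = s0 then {0} else ∅ : Finset ℕ) ↔ q = s0 ∧ i = 0 := by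
    intro q i
    split_ifs with h <;> simp [h]
  refine ⟨fun q q' i hi hi' j hj hjq => ?_, fun q i hi => ?_, 1, fun i => ⟨?_, fun hi => ?_⟩,
    fun i hi => ⟨s0, ?_, fun j hj => ?_⟩, by simp⟩
  · exact (hmem q' j).2 ⟨((hmem q' i).1 hi').1, ((hmem q j).1 hjq).2⟩
  · exact (hmem q 0).2 ⟨((hmem q i).1 hi).1, rfl⟩
  · rintro ⟨q, hq⟩
    have := ((hmem q i).1 hq).2
    omega
  · exact ⟨s0, (hmem s0 i).2 ⟨rfl, by omega⟩⟩
  · exact (hmem s0 i).2 ⟨rfl, by omega⟩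
  · have := ((hmem s0 j).1 hj).2
    omega

/-- The automaton of macrostates recognises the Büchi language. -/
theorem exists_macrostate_automaton {A S : Type} [Fintype S] (δ : S → A → Set S) (s0 : S)
    (acc : Set S) [Finite {x : (S → Finset ℕ) × ℕ // ValidState x}] :
    ∃ (δ' : {x : (S → Finset ℕ) × ℕ // ValidState x} → A →
        {x : (S → Finset ℕ) × ℕ // ValidState x})
      (t0 : {x : (S → Finset ℕ) × ℕ // ValidState x}),
      ∀ w : ℕ → A, ParityAccept
        (fun i : Fin (2 * Fintype.card S) => {x | x.1.2 = (i : ℕ)}) (DetRun δ' t0 w) ↔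
          w ∈ BuchiLang δ s0 acc := by
  classical
  have : Nonempty S := ⟨s0⟩
  refine ⟨fun x a => ⟨_, validState_step (δ := δ) (acc := acc) x.2 a⟩,
    ⟨_, validState_init s0⟩, fun w => ?_⟩
  rw [parityAccept_iff (fun x : {x : (S → Finset ℕ) × ℕ // ValidState x} => x.1.2)
    (fun x => x.2.prio_lt), mem_buchiLang_iff]
  set ρ : ℕ → {x : (S → Finset ℕ) × ℕ // ValidState x} :=
    DetRun (fun x a => ⟨_, validState_step (δ := δ) (acc := acc) x.2 a⟩)
      ⟨_, validState_init s0⟩ w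
  rw [← parity_prio_iff (h := fun t => (ρ t).1.1) ?_ (fun t => rfl)
    (fun t => (ρ t).2.2.1) (fun t i hi => (ρ t).2.lt_card hi)]
  · have hfreq : ∀ i, (∃ᶠ t in Filter.atTop, (ρ t).1.2 = i) ↔
        ∃ᶠ t in Filter.atTop, prio (spawn δ acc (ρ t).1.1 (w t)) = i :=
      fun i => (frequently_atTop_succ (p := fun t => (ρ t).1.2 = i)).symm
    simp only [hfreq]
  · intro q
    change (if q = s0 then {0} else ∅ : Finset ℕ).Nonempty ↔ q = s0
    split_ifs with h <;> simp [h]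

/-- An automaton with a single state needs only to remember whether its run is still alive. -/
theorem exists_dpw_of_subsingleton {A S : Type} [Fintype S] [Subsingleton S]
    (δ : S → A → Set S) (s0 : S) (acc : Set S) :
    ∃ (δ' : Bool → A → Bool) (t0 : Bool) (p : Bool → ℕ), (∀ x, p x < 2) ∧
      ∀ w : ℕ → A, ParityAccept (fun i : Fin 2 => {x | p x = i}) (DetRun δ' t0 w) ↔
        w ∈ BuchiLang δ s0 acc := by
  classical
  let p : Bool → ℕ := fun b => if b = true ∧ s0 ∈ acc then 0 else 1
  have hp : ∀ x, p x < 2 := fun x => by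
    simp only [p]
    split_ifs <;> omega
  refine ⟨fun b a => b && decide (s0 ∈ δ s0 a), true, p, hp, fun w => ?_⟩
  rw [parityAccept_iff p hp, mem_buchiLang_iff]
  set ρ := DetRun (fun b a => b && decide (s0 ∈ δ s0 a)) true w with hρ
  have hsucc : ∀ t, ρ (t + 1) = true ↔ ρ t = true ∧ s0 ∈ δ s0 (w t) := fun t => by
    simp [hρ, DetRun]
  have hp0 : ∀ t, p (ρ t) = 0 ↔ ρ t = true ∧ s0 ∈ acc := fun t => by
    simp only [p]
    split_ifs with h <;> simp [h]
  constructor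
  · rintro ⟨i, hi, hfreq, -⟩
    obtain ⟨t, ht⟩ := hfreq.exists
    have hlt := hp (ρ t)
    obtain rfl : i = 0 := by
      obtain ⟨k, hk⟩ := hi
      omega
    simp only [hp0] at hfreq
    obtain ⟨t, -, hacc⟩ := hfreq.exists
    refine ⟨fun _ => s0, ⟨rfl, fun t => ?_⟩, Filter.Frequently.of_forall fun _ => hacc⟩
    obtain ⟨t', ht', ht, -⟩ := Filter.frequently_atTop.1 hfreq (t + 1)
    have halive : ρ (t + 1) = true :=
      Nat.decreasingInduction (motive := fun s _ => ρ s = true)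
        (fun s _ hs => ((hsucc s).1 hs).1) ht ht'
    exact ((hsucc t).1 halive).2
  · rintro ⟨r, hr, hfreq⟩
    have hr0 : ∀ t, r t = s0 := fun t => Subsingleton.elim _ _
    obtain ⟨t, hacc⟩ := hfreq.exists
    rw [hr0] at hacc
    have hρt : ∀ t, ρ t = true := by
      intro t
      induction t with
      | zero => rfl
      | succ t ih =>
        refine (hsucc t).2 ⟨ih, ?_⟩
        have := hr.2 t
        rwa [hr0, hr0] at this
    exact ⟨0, Even.zero, Filter.Frequently.of_forall fun t => (hp0 t).2 ⟨hρt t, hacc⟩,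
      fun j hj => absurd hj (by omega)⟩

/-- For every nondeterministic Büchi word automaton `N` with
`n ≥ 1` states there exists a deterministic parity word automaton `D` with at
most `2·n^n·n!` states and parity index `2n` such that `L(D) = L(N)`. -/
theorem nbw_to_dpw (A : Type) [Fintype A] (S : Type) [Fintype S] (n : ℕ)
    (hn : 1 ≤ n) (hcard : Fintype.card S = n)
    (δ : S → A → Set S) (s0 : S) (acc : Set S) :
    ∃ (T : Type) (instT : Fintype T) (δ' : T → A → T) (t0 : T)
      (F : Fin (2 * n) → Set T),
      @Fintype.card T instT ≤ 2 * n ^ n * n.factorial ∧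
      IsPartition F ∧
      {w : ℕ → A | ParityAccept F (DetRun δ' t0 w)} = BuchiLang δ s0 acc := by
  subst hcard
  rcases hn.eq_or_lt with h1 | h2
  · have : Subsingleton S := Fintype.card_le_one_iff_subsingleton.1 h1.ge
    obtain ⟨δ', t0, p, hp, hL⟩ := exists_dpw_of_subsingleton δ s0 acc
    rw [← h1]
    exact ⟨Bool, inferInstance, δ', t0, fun i => {x | p x = i}, by simp,
      isPartition_priority p hp, Set.ext hL⟩
  · obtain ⟨k, hk⟩ : ∃ k, Fintype.card S = k + 2 := ⟨Fintype.card S - 2, by omega⟩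
    classical
    have : Nonempty S := ⟨s0⟩
    obtain ⟨f, hf⟩ := exists_code hk
    have instT : Fintype {x : (S → Finset ℕ) × ℕ // ValidState x} := Fintype.ofInjective f hf
    obtain ⟨δ', t0, hL⟩ := exists_macrostate_automaton δ s0 acc
    refine ⟨_, instT, δ', t0, fun i => {x | x.1.2 = (i : ℕ)}, ?_,
      isPartition_priority _ fun x => x.2.prio_lt, Set.ext hL⟩
    have := (Fintype.card_le_of_injective f hf).trans (card_code hk)
    rwa [hk]
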